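/- arXiv:2403.05800 — 2 statements merged into one kernel-verified Lean document; each statement's English description precedes it below -/
import Mathlib

section
/- Let p be a prime, let m, m' ≥ 2 be even integers, and let r ≥ 1 be an integer such that m ≡ m' (mod (p−1)·p^{r−1}) and r > ord_p(N_m). Then ord_p(N_m) = ord_p(N_{m'}). -/
/-- `ζ(1−m) = −B_m/m` as a rational number, for `m ≥ 1`. -/
noncomputable def zetaVal (m : ℕ) : ℚ :=
  -(bernoulli m) / (m : ℚ)

/-- `N_m`: the (positive) numerator of `ζ(1−m) = −B_m/m`. -/
noncomputable def Nzeta (m : ℕ) : ℕ :=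
  (zetaVal m).num.natAbs

open Filter Topology

theorem aux_sub {p : ℕ} [Fact p.Prime] (x y : ℚ_[p]) : ‖x - y‖ ≤ max ‖x‖ ‖y‖ := by
  rw [sub_eq_add_neg, ← norm_neg y]
  exact Padic.nonarchimedean _ _

theorem aux_T (p : ℕ) [Fact p.Prime] (m : ℕ) :
    Tendsto (fun n : ℕ => (∑ j ∈ Finset.range (p ^ n), (j : ℚ_[p]) ^ m) / (p : ℚ_[p]) ^ n)
      atTop (𝓝 ((bernoulli m : ℚ) : ℚ_[p])) := by
  have hp0 : (p : ℚ_[p]) ≠ 0 := by exact_mod_cast (Fact.out : p.Prime).ne_zero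
  set g : ℚ_[p] → ℚ_[p] := fun x => ∑ i ∈ Finset.range (m + 1),
    ((bernoulli i * ((m + 1).choose i) / (m + 1) : ℚ) : ℚ_[p]) * x ^ (m - i) with hg
  have hgc : Continuous g := by fun_prop
  have hg0 : g 0 = ((bernoulli m : ℚ) : ℚ_[p]) := by
    simp only [hg]
    rw [Finset.sum_range_succ, Finset.sum_eq_zero]
    · have : ((m : ℚ) + 1) ≠ 0 := by positivity
      simp only [Nat.choose_succ_self_right, Nat.sub_self, pow_zero, mul_one, zero_add]
      congr 1
      push_cast
      field_simp
    · intro i hi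
      have : m - i ≠ 0 := by have := Finset.mem_range.1 hi; omega
      simp [this]
  have hx : Tendsto (fun n : ℕ => (p : ℚ_[p]) ^ n) atTop (𝓝 0) :=
    tendsto_pow_atTop_nhds_zero_of_norm_lt_one Padic.norm_p_lt_one
  have := (hgc.tendsto 0).comp hx
  rw [hg0] at this
  refine this.congr fun n => ?_
  have hF := sum_range_pow (p ^ n) m
  have hF' := congrArg (fun q : ℚ => (q : ℚ_[p])) hF
  simp only [Rat.cast_sum, Rat.cast_pow, Rat.cast_natCast] at hF'
  rw [hF', eq_div_iff (pow_ne_zero _ hp0)]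
  simp only [Function.comp, hg]
  rw [Finset.sum_mul]
  refine Finset.sum_congr rfl fun i hi => ?_
  have : m + 1 - i = (m - i) + 1 := by have := Finset.mem_range.1 hi; omega
  rw [this, pow_succ]
  push_cast
  ring

theorem aux_U (p : ℕ) [Fact p.Prime] (m : ℕ) (hm : 1 ≤ m) :
    Tendsto (fun n : ℕ => (∑ j ∈ (Finset.range (p ^ (n+1))).filter (fun j => ¬ p ∣ j), (j : ℚ_[p]) ^ m) / (p : ℚ_[p]) ^ (n+1))
      atTop (𝓝 ((1 - (p : ℚ_[p]) ^ (m - 1)) * ((bernoulli m : ℚ) : ℚ_[p]))) := by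
  have hpos := (Fact.out : p.Prime).pos
  have hp0 : (p : ℚ_[p]) ≠ 0 := by exact_mod_cast (Fact.out : p.Prime).ne_zero
  have h1 := (tendsto_add_atTop_iff_nat 1).2 (aux_T p m)
  have h2 := (aux_T p m).const_mul ((p : ℚ_[p]) ^ (m - 1))
  have h3 := h1.sub h2
  rw [sub_mul, one_mul]
  refine h3.congr fun n => ?_
  have e1 : ∑ j ∈ (Finset.range (p ^ (n+1))).filter (fun j => p ∣ j), (j : ℚ_[p]) ^ m
      = (p : ℚ_[p]) ^ m * ∑ j ∈ Finset.range (p ^ n), (j : ℚ_[p]) ^ m := by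
    rw [Finset.mul_sum]
    symm
    refine Finset.sum_bij (fun j _ => p * j) ?_ ?_ ?_ ?_
    · intro j hj
      simp only [Finset.mem_filter, Finset.mem_range] at hj ⊢
      refine ⟨?_, dvd_mul_right _ _⟩
      rw [pow_succ, mul_comm]
      exact Nat.mul_lt_mul_of_pos_right hj hpos
    · intro a _ b _ h
      exact Nat.eq_of_mul_eq_mul_left hpos h
    · intro b hb
      simp only [Finset.mem_filter, Finset.mem_range] at hb
      obtain ⟨hb, c, rfl⟩ := hb
      refine ⟨c, ?_, rfl⟩
      rw [pow_succ, mul_comm] at hb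
      exact Finset.mem_range.2 (lt_of_mul_lt_mul_right hb (Nat.zero_le _))
    · intro j _
      push_cast
      ring
  have e2 := Finset.sum_filter_add_sum_filter_not (Finset.range (p ^ (n+1))) (fun j => p ∣ j)
    (fun j => (j : ℚ_[p]) ^ m)
  rw [← e2, e1]
  obtain ⟨k, rfl⟩ : ∃ k, m = k + 1 := ⟨m - 1, by omega⟩
  simp only [Nat.add_sub_cancel]
  field_simp
  ring

theorem aux_perm (p : ℕ) [Fact p.Prime] (m n a : ℕ) (ha : ¬ p ∣ a) :
    ∑ j ∈ (Finset.range (p ^ (n+1))).filter (fun j => ¬ p ∣ j), ((a * j % p ^ (n+1) : ℕ) : ℤ) ^ m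
    = ∑ j ∈ (Finset.range (p ^ (n+1))).filter (fun j => ¬ p ∣ j), (j : ℤ) ^ m := by
  have hp : p.Prime := Fact.out
  set J := (Finset.range (p ^ (n+1))).filter (fun j => ¬ p ∣ j) with hJ
  have hinj : Set.InjOn (fun j => a * j % p ^ (n+1)) J := by
    intro x hx y hy h
    simp only [hJ, Finset.coe_filter, Finset.mem_range, Set.mem_ofPred_eq] at hx hy
    have h' : a * x ≡ a * y [MOD p ^ (n+1)] := h
    have hc : (p ^ (n+1)).gcd a = 1 :=
      Nat.Coprime.pow_left _ ((Nat.Prime.coprime_iff_not_dvd hp).2 ha)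
    have := Nat.ModEq.cancel_left_of_coprime hc h'
    exact Nat.ModEq.eq_of_lt_of_lt this hx.1 hy.1
  have himg : J.image (fun j => a * j % p ^ (n+1)) = J := by
    apply Finset.eq_of_subset_of_card_le
    · intro y hy
      obtain ⟨x, hx, rfl⟩ := Finset.mem_image.1 hy
      simp only [hJ, Finset.mem_filter, Finset.mem_range] at hx ⊢
      refine ⟨Nat.mod_lt _ (pow_pos hp.pos _), fun h => ?_⟩
      have := (Nat.dvd_mod_iff (dvd_pow_self p (Nat.succ_ne_zero n))).1 h
      rcases hp.dvd_mul.1 this with h | h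
      · exact ha h
      · exact hx.2 h
    · rw [Finset.card_image_of_injOn hinj]
  conv_rhs => rw [← himg]
  rw [Finset.sum_image hinj]

noncomputable def auxW (p m n a : ℕ) : ℤ :=
  ∑ j ∈ (Finset.range (p ^ (n+1))).filter (fun j => ¬ p ∣ j),
    ((a * j / p ^ (n+1) : ℕ) : ℤ) * ((a * j : ℕ) : ℤ) ^ (m - 1)

theorem aux_cong (p : ℕ) [Fact p.Prime] (m n a : ℕ) (ha : ¬ p ∣ a) :
    ∃ k : ℤ, ((a : ℤ) ^ m - 1) * ∑ j ∈ (Finset.range (p ^ (n+1))).filter (fun j => ¬ p ∣ j), (j : ℤ) ^ m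
      - m * p ^ (n+1) * auxW p m n a = k * (p ^ (n+1)) ^ 2 := by
  have key : ∀ j : ℕ, ∃ k : ℤ, ((a * j % p ^ (n+1) : ℕ) : ℤ) ^ m =
      (a:ℤ) ^ m * (j:ℤ) ^ m - m * p ^ (n+1) * (((a * j / p ^ (n+1) : ℕ) : ℤ) * ((a * j : ℕ) : ℤ) ^ (m - 1))
      + k * (p ^ (n+1)) ^ 2 := by
    intro j
    obtain ⟨k, hk⟩ := Polynomial.powAddExpansion ((a * j : ℕ) : ℤ)
      (- ((p ^ (n+1) : ℕ) * (a * j / p ^ (n+1) : ℕ) : ℤ)) m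
    refine ⟨k * ((a * j / p ^ (n+1) : ℕ) : ℤ) ^ 2, ?_⟩
    have e : ((a * j % p ^ (n+1) : ℕ) : ℤ) = ((a * j : ℕ) : ℤ) + 
      (- ((p ^ (n+1) : ℕ) * (a * j / p ^ (n+1) : ℕ) : ℤ)) := by
      have := Nat.mod_add_div (a * j) (p ^ (n+1))
      have h2 : ((a * j % p ^ (n+1) : ℕ) : ℤ) + ((p ^ (n+1) : ℕ) * (a * j / p ^ (n+1) : ℕ) : ℤ) = ((a * j : ℕ) : ℤ) := by
        exact_mod_cast this
      linarith
    rw [e, hk]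
    have e3 : ((a * j : ℕ) : ℤ) ^ m = (a:ℤ) ^ m * (j:ℤ) ^ m := by push_cast; ring
    have e4 : ((p ^ (n+1) : ℕ) : ℤ) = (p:ℤ) ^ (n+1) := by push_cast; ring
    rw [e3, e4]
    ring
  choose k hk using key
  refine ⟨- ∑ j ∈ (Finset.range (p ^ (n+1))).filter (fun j => ¬ p ∣ j), k j, ?_⟩
  have h := aux_perm p m n a ha
  rw [Finset.sum_congr rfl (fun j _ => hk j), Finset.sum_add_distrib, Finset.sum_sub_distrib,
    ← Finset.mul_sum, ← Finset.mul_sum, ← Finset.sum_mul] at h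
  unfold auxW
  linarith

theorem aux_W_lim (p : ℕ) [Fact p.Prime] (m a : ℕ) (hm : 1 ≤ m) (ha : ¬ p ∣ a) :
    Tendsto (fun n : ℕ => ((auxW p m n a : ℤ) : ℚ_[p])) atTop
      (𝓝 (((a : ℚ_[p]) ^ m - 1) * ((1 - (p : ℚ_[p]) ^ (m - 1)) * ((bernoulli m : ℚ) : ℚ_[p])) / m)) := by
  have hp0 : (p : ℚ_[p]) ≠ 0 := by exact_mod_cast (Fact.out : p.Prime).ne_zero
  have hm0 : (m : ℚ_[p]) ≠ 0 := by exact_mod_cast (by omega : m ≠ 0)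
  choose k hk using fun n => aux_cong p m n a ha
  have hz : Tendsto (fun n : ℕ => (k n : ℚ_[p]) * (p : ℚ_[p]) ^ (n+1)) atTop (𝓝 0) := by
    have h0 : Tendsto (fun n : ℕ => (p : ℚ_[p]) ^ (n + 1)) atTop (𝓝 0) :=
      (tendsto_add_atTop_iff_nat 1).2
        (tendsto_pow_atTop_nhds_zero_of_norm_lt_one Padic.norm_p_lt_one)
    refine squeeze_zero_norm (fun n => ?_) (tendsto_zero_iff_norm_tendsto_zero.1 h0)
    rw [norm_mul]
    exact mul_le_of_le_one_left (norm_nonneg _) (Padic.norm_int_le_one _)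
  have h := (((aux_U p m hm).const_mul ((a : ℚ_[p]) ^ m - 1)).sub hz).div_const (m : ℚ_[p])
  rw [sub_zero] at h
  refine h.congr fun n => ?_
  have e := congrArg (fun z : ℤ => (z : ℚ_[p])) (hk n)
  push_cast at e
  field_simp
  linear_combination e

theorem aux_W_cong (p : ℕ) [Fact p.Prime] (m m' r n a : ℕ) (hm : 2 ≤ m) (hm' : 2 ≤ m') (hr : 1 ≤ r)
    (ha : ¬ p ∣ a) (hcong : m ≡ m' [MOD (p - 1) * p ^ (r - 1)]) :
    ((p ^ r : ℕ) : ℤ) ∣ auxW p m n a - auxW p m' n a := by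
  have hp : p.Prime := Fact.out
  unfold auxW
  rw [← Finset.sum_sub_distrib]
  refine Finset.dvd_sum fun j hj => ?_
  rw [← mul_sub]
  refine Dvd.dvd.mul_left ?_ _
  have hj' := (Finset.mem_filter.1 hj).2
  have hc : Nat.Coprime (a * j) (p ^ r) := by
    apply Nat.Coprime.pow_right
    rw [Nat.coprime_comm, Nat.Prime.coprime_iff_not_dvd hp, hp.dvd_mul]
    tauto
  have htot : (p ^ r).totient = (p - 1) * p ^ (r - 1) := by
    rw [Nat.totient_prime_pow hp (by omega), mul_comm]
  have hE := Nat.ModEq.pow_totient hc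
  rw [htot] at hE
  set φ := (p - 1) * p ^ (r - 1)
  have gen : ∀ u v : ℕ, 1 ≤ u → u ≤ v → u ≡ v [MOD φ] → (a * j) ^ (u-1) ≡ (a * j) ^ (v-1) [MOD p ^ r] := by
    intro u v hu huv h
    obtain ⟨c, hc⟩ := (Nat.modEq_iff_dvd' huv).1 h
    have : v - 1 = (u - 1) + φ * c := by omega
    rw [this, pow_add, pow_mul]
    simpa using ((hE.pow c).mul_left ((a*j)^(u-1))).symm
  have h2 : (a * j) ^ (m'-1) ≡ (a * j) ^ (m-1) [MOD p ^ r] := by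
    rcases le_total m m' with h | h
    · exact (gen m m' (by omega) h hcong).symm
    · exact gen m' m (by omega) h hcong.symm
  have := (Nat.modEq_iff_dvd).1 h2
  push_cast at this ⊢
  exact this

theorem aux_bern_ne (m : ℕ) (hm : 2 ≤ m) (he : Even m) : bernoulli m ≠ 0 := by
  obtain ⟨k, rfl⟩ := he
  intro h
  have h1 := riemannZeta_two_mul_nat (k := k) (by omega)
  rw [two_mul k, h] at h1
  have h2 : riemannZeta (2 * (k : ℂ)) ≠ 0 := by
    apply riemannZeta_ne_zero_of_one_le_re
    have : (1:ℝ) ≤ k := by exact_mod_cast (by omega : 1 ≤ k)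
    simp
    linarith
  apply h2
  rw [h1]
  simp

theorem aux_num_norm (p : ℕ) [Fact p.Prime] (z : ℚ) (hz : z ≠ 0) (h1 : ‖(z : ℚ_[p])‖ ≤ 1) :
    ‖(z : ℚ_[p])‖ = (p : ℝ) ^ (-(padicValNat p z.num.natAbs : ℤ)) := by
  have hp : p.Prime := Fact.out
  have hd : ¬ p ∣ z.den := by
    rw [← Rat.padicValuation_le_one_iff]
    exact (Padic.norm_rat_le_one_iff_padicValuation_le_one p).1 h1
  rw [Padic.eq_padicNorm, padicNorm.eq_zpow_of_nonzero hz, padicValRat, padicValInt,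
    padicValNat.eq_zero_of_not_dvd hd]
  simp

theorem aux_num_big (p : ℕ) [Fact p.Prime] (z : ℚ) (h1 : 1 < ‖(z : ℚ_[p])‖) :
    padicValNat p z.num.natAbs = 0 := by
  have hp : p.Prime := Fact.out
  apply padicValNat.eq_zero_of_not_dvd
  intro h
  have hd : ¬ p ∣ z.den := fun h' => by
    have := Nat.dvd_gcd h h'
    rw [z.reduced] at this
    exact hp.one_lt.ne' (Nat.dvd_one.1 this)
  exact absurd (Padic.norm_rat_le_one hd) (not_le.2 h1)

theorem aux_bern_norm (p : ℕ) [Fact p.Prime] (m : ℕ) (hm : 2 ≤ m) (he : Even m) (hd : p - 1 ∣ m) :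
    1 < ‖((bernoulli m : ℚ) : ℚ_[p])‖ := by
  have hp : p.Prime := Fact.out
  obtain ⟨k, hk⟩ := he
  obtain rfl : m = 2 * k := by omega
  obtain ⟨c, hc⟩ := Bernoulli.vonStaudt_clausen k
  by_contra! hle
  have hmem : p ∈ (Finset.range (2 * k + 2)).filter (fun q => q.Prime ∧ (q - 1) ∣ 2 * k) := by
    have := Nat.le_of_dvd (by omega) hd
    simp only [Finset.mem_filter, Finset.mem_range]
    exact ⟨by omega, hp, hd⟩
  rw [← Finset.add_sum_erase _ _ hmem] at hc
  have e := congrArg (fun z : ℚ => (z : ℚ_[p])) hc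
  simp only [Rat.cast_add, Rat.cast_intCast] at e
  set S : ℚ := ∑ x ∈ ((Finset.range (2 * k + 2)).filter (fun q => q.Prime ∧ (q - 1) ∣ 2 * k)).erase p, (1:ℚ)/x with hS
  have hSn : ‖(S : ℚ_[p])‖ ≤ 1 := by
    rw [hS, Rat.cast_sum]
    apply IsUltrametricDist.norm_sum_le_of_forall_le_of_nonneg zero_le_one
    intro q hq
    simp only [Finset.mem_erase, Finset.mem_filter] at hq
    have hcp : ‖(q : ℚ_[p])‖ = 1 := by
      rw [Padic.norm_natCast_eq_one_iff]
      exact (Nat.coprime_primes hp hq.2.2.1).2 (Ne.symm hq.1)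
    simp [hcp]
  have h3 : ((1 / p : ℚ) : ℚ_[p]) = (c - ((bernoulli (2 * k) : ℚ) : ℚ_[p])) - S := by
    rw [e]; ring
  have h4 : ‖((1 / p : ℚ) : ℚ_[p])‖ ≤ 1 := by
    rw [h3]
    refine (aux_sub _ _).trans (max_le ?_ hSn)
    exact (aux_sub _ _).trans (max_le (Padic.norm_int_le_one _) hle)
  have h5 : (1:ℝ) < p := by exact_mod_cast hp.one_lt
  have h6 : ‖((1 / p : ℚ) : ℚ_[p])‖ = p := by simp
  linarith

theorem aux_prim (p : ℕ) [Fact p.Prime] :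
    ∃ a : ℕ, ¬ p ∣ a ∧ ∀ m, ¬ (p - 1 ∣ m) → ‖(a : ℚ_[p]) ^ m - 1‖ = 1 := by
  have hp : p.Prime := Fact.out
  obtain ⟨g, hg⟩ := IsCyclic.exists_generator (α := (ZMod p)ˣ)
  have hord : orderOf g = p - 1 := by
    rw [orderOf_eq_card_of_forall_mem_zpowers hg, Nat.card_eq_fintype_card, ZMod.card_units]
  have hcast : (((g : ZMod p).val : ℕ) : ZMod p) = g := ZMod.natCast_zmod_val _
  refine ⟨(g : ZMod p).val, ?_, ?_⟩
  · rw [← ZMod.natCast_eq_zero_iff, hcast]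
    exact g.ne_zero
  · intro m hm
    set a := (g : ZMod p).val
    have e : (a : ℚ_[p]) ^ m - 1 = (((a : ℤ) ^ m - 1 : ℤ) : ℚ_[p]) := by push_cast; ring
    rw [e]
    refine le_antisymm (Padic.norm_int_le_one _) (not_lt.1 fun h => ?_)
    rw [Padic.norm_intCast_lt_one_iff, ← ZMod.intCast_zmod_eq_zero_iff_dvd] at h
    push_cast at h
    rw [hcast, sub_eq_zero] at h
    apply hm
    rw [← hord, orderOf_dvd_iff_pow_eq_one]
    ext
    simpa using h

/-- Kummer-congruence-type corollary: let `p` be prime, `m, m' ≥ 2` even,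
and `r ≥ 1` with `m ≡ m' (mod (p−1)p^{r−1})` and `r > ord_p(N_m)`.  Then
`ord_p(N_m) = ord_p(N_{m'})`. -/
theorem zeta_numerator_congruence (p : ℕ) (hp : p.Prime) (m m' r : ℕ)
    (hm : 2 ≤ m) (hm' : 2 ≤ m') (hme : Even m) (hme' : Even m')
    (hr : 1 ≤ r) (hcong : m ≡ m' [MOD (p - 1) * p ^ (r - 1)])
    (hord : padicValNat p (Nzeta m) < r) :
    padicValNat p (Nzeta m) = padicValNat p (Nzeta m') := by
  have : Fact p.Prime := ⟨hp⟩
  have hdvd : p - 1 ∣ m ↔ p - 1 ∣ m' := (hcong.of_mul_right _).dvd_iff dvd_rfl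
  have hznorm : ∀ k, ‖((zetaVal k : ℚ) : ℚ_[p])‖ = ‖((bernoulli k : ℚ) : ℚ_[p])‖ / ‖(k : ℚ_[p])‖ := by
    intro k
    simp [zetaVal]
  by_cases hd : p - 1 ∣ m
  · have main : ∀ k, 2 ≤ k → Even k → p - 1 ∣ k → padicValNat p (Nzeta k) = 0 := by
      intro k hk he hdk
      apply aux_num_big
      rw [hznorm]
      have h0 : 0 < ‖(k : ℚ_[p])‖ := norm_pos_iff.2 (by exact_mod_cast (by omega : k ≠ 0))
      have h1 : ‖(k : ℚ_[p])‖ ≤ 1 := by exact_mod_cast Padic.norm_int_le_one (p := p) k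
      rw [lt_div_iff₀ h0, one_mul]
      exact h1.trans_lt (aux_bern_norm p k hk he hdk)
    rw [main m hm hme hd, main m' hm' hme' (hdvd.1 hd)]
  · have hd' : ¬ p - 1 ∣ m' := fun h => hd (hdvd.2 h)
    obtain ⟨a, ha, hau⟩ := aux_prim p
    have hl := aux_W_lim p m a (by omega) ha
    have hl' := aux_W_lim p m' a (by omega) ha
    set X := ((a : ℚ_[p]) ^ m - 1) * ((1 - (p : ℚ_[p]) ^ (m - 1)) * ((bernoulli m : ℚ) : ℚ_[p])) / m with hX
    set X' := ((a : ℚ_[p]) ^ m' - 1) * ((1 - (p : ℚ_[p]) ^ (m' - 1)) * ((bernoulli m' : ℚ) : ℚ_[p])) / m' with hX'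
    have hu : ∀ k, 2 ≤ k → ‖1 - (p : ℚ_[p]) ^ (k - 1)‖ = 1 := by
      intro k hk
      have hlt : ‖-(p : ℚ_[p]) ^ (k - 1)‖ < 1 := by
        rw [norm_neg, norm_pow]
        exact pow_lt_one₀ (norm_nonneg _) Padic.norm_p_lt_one (by omega)
      rw [sub_eq_add_neg, Padic.add_eq_max_of_ne (by rw [norm_one]; exact hlt.ne'), norm_one]
      exact max_eq_left hlt.le
    have hXn : ‖X‖ = ‖((zetaVal m : ℚ) : ℚ_[p])‖ := by
      rw [hX, norm_div, norm_mul, norm_mul, hau m hd, hu m hm, hznorm]; ring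
    have hXn' : ‖X'‖ = ‖((zetaVal m' : ℚ) : ℚ_[p])‖ := by
      rw [hX', norm_div, norm_mul, norm_mul, hau m' hd', hu m' hm', hznorm]; ring
    have hX1 : ‖X‖ ≤ 1 := le_of_tendsto' hl.norm fun n => Padic.norm_int_le_one _
    have hX1' : ‖X'‖ ≤ 1 := le_of_tendsto' hl'.norm fun n => Padic.norm_int_le_one _
    have hdiff : ‖X' - X‖ ≤ (p : ℝ) ^ (-r : ℤ) := by
      refine le_of_tendsto' (hl'.sub hl).norm fun n => ?_
      have := aux_W_cong p m' m r n a hm' hm hr ha hcong.symm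
      rw [← Int.cast_sub, Padic.norm_int_le_pow_iff_dvd]
      exact_mod_cast this
    have hnz : ∀ k, 2 ≤ k → Even k → zetaVal k ≠ 0 := by
      intro k hk he
      exact div_ne_zero (neg_ne_zero.2 (aux_bern_ne k hk he)) (by exact_mod_cast (by omega : k ≠ 0))
    have v := aux_num_norm p _ (hnz m hm hme) (hXn ▸ hX1)
    have v' := aux_num_norm p _ (hnz m' hm' hme') (hXn' ▸ hX1')
    have hp1 : (1:ℝ) < p := by exact_mod_cast hp.one_lt
    have hlt : ‖X' - X‖ < ‖X‖ := by
      refine hdiff.trans_lt ?_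
      rw [hXn, v]
      apply zpow_lt_zpow_right₀ hp1
      have : padicValNat p (zetaVal m).num.natAbs < r := hord
      omega
    have heq : ‖X'‖ = ‖X‖ := by
      have : X' = (X' - X) + X := by ring
      rw [this, Padic.add_eq_max_of_ne hlt.ne, max_eq_right hlt.le]
    rw [hXn, hXn', v, v'] at heq
    have := zpow_right_injective₀ (by linarith) hp1.ne' heq
    simp only [neg_inj, Nat.cast_inj] at this
    exact this.symm
end

section
/- Let p be an odd prime and let x, y ≥ 2 be integers such that (p−1) divides x and (p−1) divides y (hence x, y, x+y are even). For an even integer m ≥ 2 set Z(m) := (1 − p^{m−1})·(−B_m/m) ∈ ℚ (note Z(m) ≠ 0). Then the rational number Z(x)·Z(y)/Z(x+y) − Z(x) − Z(y) is p-integral, i.e. its denominator in lowest terms is not divisible by p. -/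
/-- `Z(m) := (1 − p^{m−1})(−B_m/m) ∈ ℚ`, the `p`-Euler-factor-removed zeta
value `(1 − p^{m−1})ζ(1−m)`. -/
noncomputable def Zval (p m : ℕ) : ℚ :=
  (1 - (p : ℚ) ^ (m - 1)) * (-(bernoulli m) / (m : ℚ))

open Finset Filter Topology

namespace EZ
variable {p : ℕ} [hp : Fact p.Prime]

def Cg (δ : ℝ) (u v : ℚ_[p]) : Prop := ‖u‖ ≤ 1 ∧ ‖v‖ ≤ 1 ∧ ‖u - v‖ ≤ δ

lemma Cg.add {δ : ℝ} {u v u' v' : ℚ_[p]} (h : Cg δ u v) (h' : Cg δ u' v') :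
    Cg δ (u + u') (v + v') := by
  obtain ⟨a, b, c⟩ := h
  obtain ⟨a', b', c'⟩ := h'
  refine ⟨(Padic.nonarchimedean _ _).trans (max_le a a'),
    (Padic.nonarchimedean _ _).trans (max_le b b'), ?_⟩
  rw [show u + u' - (v + v') = (u - v) + (u' - v') by ring]
  exact (Padic.nonarchimedean _ _).trans (max_le c c')

lemma Cg.mul {δ : ℝ} {u v u' v' : ℚ_[p]} (h : Cg δ u v) (h' : Cg δ u' v') :
    Cg δ (u * u') (v * v') := by
  obtain ⟨a, b, c⟩ := h
  obtain ⟨a', b', c'⟩ := h'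
  have hd : 0 ≤ δ := (norm_nonneg _).trans c
  refine ⟨?_, ?_, ?_⟩
  · rw [norm_mul]; exact mul_le_one₀ a (norm_nonneg _) a'
  · rw [norm_mul]; exact mul_le_one₀ b (norm_nonneg _) b'
  rw [show u * u' - (v * v') = (u - v) * u' + v * (u' - v') by ring]
  refine (Padic.nonarchimedean _ _).trans (max_le ?_ ?_)
  · rw [norm_mul]
    calc _ ≤ δ * 1 := mul_le_mul c a' (norm_nonneg _) hd
      _ = δ := mul_one _
  · rw [norm_mul]
    calc _ ≤ 1 * δ := mul_le_mul b c' (norm_nonneg _) zero_le_one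
      _ = δ := one_mul _

lemma Cg.const {δ : ℝ} (hδ : 0 ≤ δ) {u : ℚ_[p]} (h : ‖u‖ ≤ 1) : Cg δ u u :=
  ⟨h, h, by simpa using hδ⟩

lemma Cg.sum {δ : ℝ} (hδ : 0 ≤ δ) {ι : Type*} (s : Finset ι) (f g : ι → ℚ_[p])
    (h : ∀ i ∈ s, Cg δ (f i) (g i)) : Cg δ (∑ i ∈ s, f i) (∑ i ∈ s, g i) := by
  classical
  induction s using Finset.induction_on with
  | empty => simpa using Cg.const hδ (by simp : ‖(0 : ℚ_[p])‖ ≤ 1)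
  | insert a s ha ih =>
    rw [sum_insert ha, sum_insert ha]
    exact (h a (mem_insert_self _ _)).add (ih fun i hi => h i (mem_insert_of_mem hi))

lemma Cg.prod {δ : ℝ} (hδ : 0 ≤ δ) {ι : Type*} (s : Finset ι) (f g : ι → ℚ_[p])
    (h : ∀ i ∈ s, Cg δ (f i) (g i)) : Cg δ (∏ i ∈ s, f i) (∏ i ∈ s, g i) := by
  classical
  induction s using Finset.induction_on with
  | empty => simpa using Cg.const hδ (by simp : ‖(1 : ℚ_[p])‖ ≤ 1)
  | insert a s ha ih =>
    rw [prod_insert ha, prod_insert ha]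
    exact (h a (mem_insert_self _ _)).mul (ih fun i hi => h i (mem_insert_of_mem hi))

lemma natle (n : ℕ) : ‖(n : ℚ_[p])‖ ≤ 1 := by
  simpa using Padic.norm_int_le_one (p := p) (n : ℤ)

lemma nat_unit {n : ℕ} (h : ¬ p ∣ n) : ‖(n : ℚ_[p])‖ = 1 := by
  refine le_antisymm (natle n) (not_lt.1 fun hl => h ?_)
  have := (Padic.norm_intCast_lt_one_iff (p := p) (k := (n : ℤ))).1 (by simpa using hl)
  exact_mod_cast this

lemma Cg.nat (m n : ℕ) : Cg (p := p) ‖(m : ℚ_[p]) - n‖ m n :=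
  ⟨natle _, natle _, le_rfl⟩

lemma pne : (p : ℚ_[p]) ≠ 0 := by exact_mod_cast hp.out.ne_zero

/-- coefficient bound -/
lemma coef (hodd : p ≠ 2) (k : ℕ) : ‖(p : ℚ_[p]) ^ k / ((k + 2).factorial : ℚ_[p])‖ ≤ 1 := by
  have h2 : 3 ≤ p := by have := hp.out.two_le; omega
  have hv := sub_one_mul_padicValNat_factorial (p := p) (k + 2)
  have hds : 1 ≤ (p.digits (k + 2)).sum := by
    by_contra hc
    have h0 : (p.digits (k+2)).sum = 0 := by omega
    have := Nat.modEq_digits_sum p (p) 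
    have h1 : ∀ x ∈ p.digits (k+2), x = 0 := by
      intro x hx
      have := List.single_le_sum (l := p.digits (k+2)) (by simp) x hx
      omega
    have hne : p.digits (k+2) ≠ [] := Nat.digits_ne_nil_iff_ne_zero.2 (by omega)
    exact Nat.getLast_digit_ne_zero p (by omega : k+2 ≠ 0) (h1 _ (List.getLast_mem hne))
  have hle : padicValNat p (k + 2).factorial ≤ k := by
    have : 2 * padicValNat p (k + 2).factorial ≤ (p - 1) * padicValNat p (k + 2).factorial :=
      Nat.mul_le_mul_right _ (by omega)
    omega
  have hf : ((k + 2).factorial : ℚ_[p]) ≠ 0 := by exact_mod_cast Nat.factorial_ne_zero _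
  rw [norm_div, div_le_one (norm_pos_iff.2 hf), norm_pow, Padic.norm_p]
  rw [Padic.norm_eq_zpow_neg_valuation hf, Padic.valuation_natCast, inv_pow, ← zpow_natCast,
    ← zpow_neg]
  apply zpow_le_zpow_right₀
  · exact_mod_cast hp.out.one_le
  · omega

lemma cast_desc (m k : ℕ) : (m.descFactorial k : ℚ_[p]) = ∏ i ∈ range k, ((m : ℚ_[p]) - i) := by
  induction k with
  | zero => simp
  | succ k ih =>
    rw [Nat.descFactorial_succ, prod_range_succ, ← ih]
    by_cases h : k ≤ m
    · push_cast [Nat.cast_sub h]; ring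
    · rw [Nat.descFactorial_of_lt (by omega)]; simp

noncomputable def R (s : ℕ) (t : ℚ_[p]) (M m : ℕ) : ℚ_[p] :=
  ∑ k ∈ range M, ((p : ℚ_[p]) ^ (s * (k + 1)) * ((p : ℚ_[p]) ^ k / ((k + 2).factorial : ℚ_[p])) * t ^ (k + 2))
    * ∏ i ∈ range (k + 1), ((m : ℚ_[p]) - (i + 1 : ℕ))

lemma Cg.R (hodd : p ≠ 2) (s : ℕ) {t : ℚ_[p]} (ht : ‖t‖ ≤ 1) (M m n : ℕ) :
    Cg ‖(m : ℚ_[p]) - n‖ (R s t M m) (R s t M n) := by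
  apply Cg.sum (norm_nonneg _)
  intro k _
  apply Cg.mul
  · apply Cg.const (norm_nonneg _)
    rw [norm_mul, norm_mul, norm_pow, norm_pow]
    refine mul_le_one₀ (mul_le_one₀ (pow_le_one₀ (norm_nonneg _) (natle p)) (norm_nonneg _)
      (coef hodd k)) (by positivity) (pow_le_one₀ (norm_nonneg _) ht)
  · apply Cg.prod (norm_nonneg _)
    intro i _
    rw [sub_eq_add_neg (m : ℚ_[p]) ((i + 1 : ℕ) : ℚ_[p]), sub_eq_add_neg (n : ℚ_[p]) ((i + 1 : ℕ) : ℚ_[p])]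
    refine (Cg.nat (p := p) m n).add (Cg.const (norm_nonneg _) ?_)
    rw [norm_neg]; exact natle _

lemma expand (s : ℕ) (t : ℚ_[p]) (M m : ℕ) (h : m ≤ M) :
    (1 + (p : ℚ_[p]) ^ (s + 1) * t) ^ m - 1 =
      m * ((p : ℚ_[p]) ^ (s + 1) * t + (p : ℚ_[p]) ^ (s + 2) * R s t M m) := by
  have h1 : (1 + (p : ℚ_[p]) ^ (s + 1) * t) ^ m =
      ∑ k ∈ range (M + 2), ((p : ℚ_[p]) ^ (s + 1) * t) ^ k * (m.choose k : ℚ_[p]) := by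
    rw [add_comm, add_pow]
    simp only [one_pow, mul_one]
    apply sum_subset
    · intro a; simp; omega
    · intro a _ ha
      rw [Nat.choose_eq_zero_of_lt (by simpa using ha)]; simp
  rw [h1, sum_range_succ', sum_range_succ']
  simp only [R, mul_add, mul_sum]
  have : ∀ k ∈ range M, ((p : ℚ_[p]) ^ (s + 1) * t) ^ (k + 1 + 1) * (m.choose (k + 1 + 1) : ℚ_[p]) =
      m * ((p : ℚ_[p]) ^ (s + 2) * (((p : ℚ_[p]) ^ (s * (k + 1)) * ((p : ℚ_[p]) ^ k / ((k + 2).factorial : ℚ_[p])) * t ^ (k + 2))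
    * ∏ i ∈ range (k + 1), ((m : ℚ_[p]) - (i + 1 : ℕ)))) := by
    intro k _
    have hd := cast_desc (p := p) m (k + 2)
    rw [Nat.descFactorial_eq_factorial_mul_choose, prod_range_succ'] at hd
    have hf : ((k + 2).factorial : ℚ_[p]) ≠ 0 := by exact_mod_cast Nat.factorial_ne_zero _
    have hc : (m.choose (k + 2) : ℚ_[p]) =
      (∏ i ∈ range (k + 1), ((m : ℚ_[p]) - (i + 1 : ℕ))) * m / ((k + 2).factorial : ℚ_[p]) := by
      rw [eq_div_iff hf, mul_comm]; push_cast at hd ⊢; rw [hd]; simp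
    rw [show k + 1 + 1 = k + 2 from rfl, hc]
    field_simp
    ring
  rw [sum_congr rfl this]
  simp only [zero_add, pow_one, pow_zero, Nat.choose_one_right, Nat.choose_zero_right, Nat.cast_one]
  rw [mul_one, mul_comm (m : ℚ_[p]) ((p : ℚ_[p]) ^ (s + 1) * t), add_sub_cancel_right, add_comm]
  simp only [mul_add, mul_one]

/-- unit powers -/
lemma unit_pow (a : ℕ) (ha : ¬ p ∣ a) : ∃ t : ℚ_[p], ‖t‖ ≤ 1 ∧ (a : ℚ_[p]) ^ (p - 1) = 1 + p * t := by
  have h : (a : ℤ) ^ (p - 1) ≡ 1 [ZMOD p] := by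
    apply Int.ModEq.pow_card_sub_one_eq_one hp.out
    rw [Nat.isCoprime_iff_coprime]
    exact ((Nat.Prime.coprime_iff_not_dvd hp.out).2 ha).symm
  obtain ⟨c, hc⟩ := h.symm.dvd
  refine ⟨c, Padic.norm_int_le_one c, ?_⟩
  have : ((a : ℤ) : ℚ_[p]) ^ (p - 1) = 1 + (p : ℤ) * (c : ℚ_[p]) := by
    rw [← sub_eq_iff_eq_add']; exact_mod_cast congrArg (Int.cast : ℤ → ℚ_[p]) hc
  simpa using this

lemma punit : ‖((p - 1 : ℕ) : ℚ_[p])‖ = 1 := by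
  apply nat_unit
  intro h
  have := Nat.le_of_dvd (by have := hp.out.two_le; omega) h
  have := hp.out.two_le
  omega

lemma base (hodd : p ≠ 2) (a : ℕ) (ha : ¬ p ∣ a) (m n : ℕ) (hm : m ≠ 0) (hn : n ≠ 0)
    (hdm : (p - 1) ∣ m) (hdn : (p - 1) ∣ n) :
    Cg ‖(m : ℚ_[p]) - n‖ (((a : ℚ_[p]) ^ m - 1) / (m : ℚ_[p]) / (p : ℚ_[p]))
      (((a : ℚ_[p]) ^ n - 1) / (n : ℚ_[p]) / (p : ℚ_[p])) := by
  obtain ⟨t, ht, hat⟩ := unit_pow a ha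
  obtain ⟨m', rfl⟩ := hdm
  obtain ⟨n', rfl⟩ := hdn
  have hu := punit (p := p)
  have hu0 : ((p - 1 : ℕ) : ℚ_[p]) ≠ 0 := by rw [← norm_pos_iff, hu]; norm_num
  have hm0 : (m' : ℚ_[p]) ≠ 0 := by
    have := right_ne_zero_of_mul hm
    exact_mod_cast this
  have hn0 : (n' : ℚ_[p]) ≠ 0 := by
    have := right_ne_zero_of_mul hn
    exact_mod_cast this
  have hp0 := pne (p := p)
  have key : ∀ r : ℕ, (r : ℚ_[p]) ≠ 0 → r ≤ m' + n' →
      ((a : ℚ_[p]) ^ ((p - 1) * r) - 1) / ((p - 1) * r : ℕ) / p =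
      (((p - 1 : ℕ) : ℚ_[p]))⁻¹ * (t + p * R 0 t (m' + n') r) := by
    intro r hr hrl
    have := expand 0 t (m' + n') r hrl
    rw [pow_mul, hat]
    simp only [zero_add, pow_one] at this
    rw [this, Nat.cast_mul]
    field_simp
  rw [key m' hm0 (by omega), key n' hn0 (by omega)]
  have hnorm : ‖(((p - 1) * m' : ℕ) : ℚ_[p]) - ((p - 1) * n' : ℕ)‖ = ‖(m' : ℚ_[p]) - n'‖ := by
    rw [Nat.cast_mul, Nat.cast_mul, ← mul_sub, norm_mul, hu, one_mul]
  rw [hnorm]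
  have c := @Cg.const p _ ‖(m' : ℚ_[p]) - n'‖ (norm_nonneg _)
  exact (c (by rw [norm_inv, hu]; simp)).mul ((c ht).add ((c (natle p)).mul (Cg.R hodd 0 ht _ _ _)))

lemma Cgpow (hodd : p ≠ 2) (a : ℕ) (ha : ¬ p ∣ a) (m n : ℕ) (hm : m ≠ 0) (hn : n ≠ 0)
    (hdm : (p - 1) ∣ m) (hdn : (p - 1) ∣ n) :
    Cg ‖(m : ℚ_[p]) - n‖ ((a : ℚ_[p]) ^ m) ((a : ℚ_[p]) ^ n) := by
  have hm0 : (m : ℚ_[p]) ≠ 0 := by exact_mod_cast hm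
  have hn0 : (n : ℚ_[p]) ≠ 0 := by exact_mod_cast hn
  have hp0 := pne (p := p)
  have c := @Cg.const p _ ‖(m : ℚ_[p]) - n‖ (norm_nonneg _)
  have := (c (u := 1) (by simp)).add (((c (natle p)).mul (Cg.nat m n)).mul (base hodd a ha m n hm hn hdm hdn))
  convert this using 1 <;> field_simp <;> ring

/-- the partial Volkenborn sums -/
noncomputable def W (N m : ℕ) : ℚ_[p] :=
  (∑ a ∈ range (p ^ N), if p ∣ a then 0 else ((a : ℚ_[p]) ^ m - 1) / m) / (p : ℚ_[p]) ^ N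

lemma sum_range_mul' {A : Type*} [AddCommMonoid A] (F : ℕ → A) (q r : ℕ) :
    ∑ b ∈ range (q * r), F b = ∑ a ∈ range q, ∑ j ∈ range r, F (a + j * q) := by
  rw [sum_comm]
  induction r with
  | zero => simp
  | succ r ih =>
    rw [mul_add, mul_one, sum_range_add, sum_range_succ, ih]
    congr 1
    apply sum_congr rfl; intros; congr 1; ring

lemma step (hodd : p ≠ 2) (N : ℕ) (m n : ℕ) (hm : m ≠ 0) (hn : n ≠ 0)
    (hdm : (p - 1) ∣ m) (hdn : (p - 1) ∣ n) :
    Cg (p := p) ‖(m : ℚ_[p]) - n‖ (W (N + 2) m - W (N + 1) m) (W (N + 2) n - W (N + 1) n) := by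
  have hp0 := pne (p := p)
  have h2 : ¬ p ∣ 2 := fun h => hodd ((Nat.prime_dvd_prime_iff_eq hp.out Nat.prime_two).1 h)
  have h2n : ‖(2 : ℚ_[p])‖ = 1 := by simpa using nat_unit (p := p) h2
  have h20 : (2 : ℚ_[p]) ≠ 0 := two_ne_zero
  have key : ∀ r : ℕ, r ≠ 0 → r ≤ m + n → W (p := p) (N + 2) r - W (N + 1) r =
      ∑ a ∈ range (p ^ (N + 1)), if p ∣ a then 0 else
        (a : ℚ_[p]) ^ r * ((((p - 1 : ℕ) : ℚ_[p]) * 2⁻¹ * (a : ℚ_[p])⁻¹) +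
          ∑ j ∈ range p, R N ((j : ℚ_[p]) * (a : ℚ_[p])⁻¹) (m + n) r) := by
    intro r hr hrl
    have hr0 : (r : ℚ_[p]) ≠ 0 := by exact_mod_cast hr
    have e1 : W (p := p) (N + 1) r = (∑ a ∈ range (p ^ (N + 1)), ∑ j ∈ range p,
        if p ∣ a then 0 else ((a : ℚ_[p]) ^ r - 1) / r) / (p : ℚ_[p]) ^ (N + 2) := by
      simp only [W, sum_const, card_range, nsmul_eq_mul, ← mul_sum]
      field_simp
      ring
    rw [e1, W, pow_succ p (N + 1), sum_range_mul', ← sub_div, ← sum_sub_distrib, sum_div]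
    apply sum_congr rfl
    intro a _
    rw [← sum_sub_distrib]
    have hdv : ∀ j, p ∣ a + j * p ^ (N + 1) ↔ p ∣ a := fun j =>
      (Nat.dvd_add_iff_left (Dvd.dvd.mul_left (dvd_pow_self p (by omega)) j)).symm
    simp only [hdv]
    split_ifs with hpa
    · simp
    have ha0 : (a : ℚ_[p]) ≠ 0 := by
      rw [← norm_pos_iff, nat_unit hpa]; norm_num
    have e2 : ∀ j ∈ range p, ((((a + j * p ^ (N + 1) : ℕ) : ℚ_[p]) ^ r - 1) / r - ((a : ℚ_[p]) ^ r - 1) / r)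
        = (a : ℚ_[p]) ^ r * ((p : ℚ_[p]) ^ (N + 1) * ((j : ℚ_[p]) * (a : ℚ_[p])⁻¹) +
          (p : ℚ_[p]) ^ (N + 2) * R N ((j : ℚ_[p]) * (a : ℚ_[p])⁻¹) (m + n) r) := by
      intro j _
      have hx := expand N ((j : ℚ_[p]) * (a : ℚ_[p])⁻¹) (m + n) r hrl
      have hy : ((a + j * p ^ (N + 1) : ℕ) : ℚ_[p]) =
          a * (1 + (p : ℚ_[p]) ^ (N + 1) * ((j : ℚ_[p]) * (a : ℚ_[p])⁻¹)) := by
        push_cast; field_simp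
      rw [hy, mul_pow, ← sub_div, div_eq_iff hr0]
      linear_combination (a : ℚ_[p]) ^ r * hx
    rw [sum_congr rfl e2, ← mul_sum, sum_add_distrib, ← mul_sum, ← mul_sum, ← sum_mul]
    have e3 : (∑ j ∈ range p, (j : ℚ_[p])) = p * ((p - 1 : ℕ) : ℚ_[p]) * 2⁻¹ := by
      rw [eq_mul_inv_iff_mul_eq₀ h20]
      have := congrArg (Nat.cast : ℕ → ℚ_[p]) (sum_range_id_mul_two p)
      simpa only [Nat.cast_mul, Nat.cast_sum, Nat.cast_ofNat] using this
    rw [e3]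
    field_simp
    ring
  rw [key m hm (by omega), key n hn (by omega)]
  have c := @Cg.const p _ ‖(m : ℚ_[p]) - n‖ (norm_nonneg _)
  apply Cg.sum (norm_nonneg _)
  intro a _
  split_ifs with hpa
  · exact c (by simp)
  have hai : ‖(a : ℚ_[p])⁻¹‖ ≤ 1 := by rw [norm_inv, nat_unit hpa]; simp
  refine (Cgpow hodd a hpa m n hm hn hdm hdn).mul (Cg.add (c ?_) (Cg.sum (norm_nonneg _) _ _ _ ?_))
  · rw [norm_mul, norm_mul, norm_inv, h2n, punit]; simpa using hai
  · intro j _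
    apply Cg.R hodd
    rw [norm_mul]
    exact mul_le_one₀ (natle j) (norm_nonneg _) hai

lemma CgW (hodd : p ≠ 2) (N : ℕ) (m n : ℕ) (hm : m ≠ 0) (hn : n ≠ 0)
    (hdm : (p - 1) ∣ m) (hdn : (p - 1) ∣ n) :
    Cg (p := p) ‖(m : ℚ_[p]) - n‖ (W (N + 1) m) (W (N + 1) n) := by
  induction N with
  | zero =>
    simp only [W, zero_add, pow_one, sum_div]
    apply Cg.sum (norm_nonneg _)
    intro a _
    split_ifs with h
    · exact Cg.const (norm_nonneg _) (by simp)
    · exact base hodd a h m n hm hn hdm hdn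
  | succ N ih =>
    have := ih.add (step hodd N m n hm hn hdm hdn)
    simpa using this

end EZ

namespace EZ
variable {p : ℕ} [hp : Fact p.Prime]

lemma tend_q : Tendsto (fun N : ℕ => (p : ℚ_[p]) ^ N) atTop (𝓝 0) :=
  tendsto_pow_atTop_nhds_zero_of_norm_lt_one Padic.norm_p_lt_one

lemma tend_sum (m : ℕ) : Tendsto (fun N : ℕ => (∑ a ∈ range (p ^ N), (a : ℚ_[p]) ^ m) / (p : ℚ_[p]) ^ N)
    atTop (𝓝 ((bernoulli m : ℚ) : ℚ_[p])) := by
  have e : ∀ N : ℕ, (∑ a ∈ range (p ^ N), (a : ℚ_[p]) ^ m) / (p : ℚ_[p]) ^ N =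
      ∑ i ∈ range m, (((bernoulli i * ((m + 1).choose i) / (m + 1) : ℚ) : ℚ_[p])
        * ((p : ℚ_[p]) ^ N) ^ (m - i)) + ((bernoulli m : ℚ) : ℚ_[p]) := by
    intro N
    have h := congrArg (Rat.cast : ℚ → ℚ_[p]) (sum_range_pow (p ^ N) m)
    have hq : ((p : ℚ_[p]) ^ N) ≠ 0 := pow_ne_zero _ pne
    have hm : (m + 1 : ℚ_[p]) ≠ 0 := by exact_mod_cast Nat.succ_ne_zero m
    rw [div_eq_iff hq]
    push_cast at h ⊢
    rw [h, sum_range_succ, add_mul, sum_mul]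
    congr 1
    · apply sum_congr rfl
      intro i hi
      rw [show m + 1 - i = (m - i) + 1 by have := mem_range.1 hi; omega, pow_succ]
      ring
    · rw [Nat.choose_succ_self_right, show m + 1 - m = 1 by omega]
      push_cast
      field_simp
  simp only [e]
  have : Tendsto (fun N : ℕ => ∑ i ∈ range m, (((bernoulli i * ((m + 1).choose i) / (m + 1) : ℚ) : ℚ_[p])
        * ((p : ℚ_[p]) ^ N) ^ (m - i)) + ((bernoulli m : ℚ) : ℚ_[p])) atTop
      (𝓝 (∑ i ∈ range m, (((bernoulli i * ((m + 1).choose i) / (m + 1) : ℚ) : ℚ_[p]) * 0 ^ (m - i))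
        + ((bernoulli m : ℚ) : ℚ_[p]))) :=
    (tendsto_finsetSum _ fun i _ => (tend_q.pow _).const_mul _).add_const _
  rwa [sum_eq_zero, zero_add] at this
  intro i hi
  rw [zero_pow, mul_zero]
  have := mem_range.1 hi; omega

lemma sum_prime_to (F : ℕ → ℚ_[p]) (N : ℕ) :
    (∑ a ∈ range (p ^ (N + 1)), if p ∣ a then 0 else F a) =
      ∑ a ∈ range (p ^ (N + 1)), F a - ∑ b ∈ range (p ^ N), F (p * b) := by
  rw [eq_sub_iff_add_eq, ← eq_sub_iff_add_eq', ← sum_sub_distrib]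
  have : ∀ a, F a - (if p ∣ a then 0 else F a) = if p ∣ a then F a else 0 := by
    intro a; split_ifs <;> simp
  simp only [this]
  rw [pow_succ', sum_range_mul']
  symm
  rw [sum_eq_single 0]
  · apply sum_congr rfl; intro j _
    rw [zero_add, if_pos (Dvd.intro_left j rfl), mul_comm]
  · intro a ha h0
    apply sum_eq_zero
    intro j _
    rw [if_neg]
    rw [← Nat.dvd_add_iff_left (Dvd.intro_left j rfl)]
    intro h
    have := Nat.le_of_dvd (by omega) h
    have := mem_range.1 ha
    omega
  · intro h
    exact absurd (mem_range.2 hp.out.pos) h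

noncomputable def G (p : ℕ) [Fact p.Prime] (m : ℕ) : ℚ_[p] :=
  ((1 - (p : ℚ_[p]) ^ (m - 1)) * ((bernoulli m : ℚ) : ℚ_[p]) - ((p : ℚ_[p]) - 1) / p) / m

lemma tendW (m : ℕ) (hm : m ≠ 0) : Tendsto (fun N => W (p := p) (N + 1) m) atTop (𝓝 (G p m)) := by
  have hm0 : (m : ℚ_[p]) ≠ 0 := by exact_mod_cast hm
  have hp0 := pne (p := p)
  have e : ∀ N, W (p := p) (N + 1) m =
      (((∑ a ∈ range (p ^ (N + 1)), (a : ℚ_[p]) ^ m) / (p : ℚ_[p]) ^ (N + 1)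
       - (p : ℚ_[p]) ^ (m - 1) * ((∑ a ∈ range (p ^ N), (a : ℚ_[p]) ^ m) / (p : ℚ_[p]) ^ N))
       - ((p : ℚ_[p]) - 1) / p) / m := by
    intro N
    obtain ⟨k, rfl⟩ := Nat.exists_eq_succ_of_ne_zero hm
    rw [W, sum_prime_to]
    simp only [← sum_div, sum_sub_distrib, Nat.cast_mul, mul_pow, ← mul_sum, sum_const, card_range,
      nsmul_eq_mul, mul_one, Nat.cast_pow, Nat.succ_eq_add_one, Nat.add_sub_cancel]
    field_simp
    ring
  simp only [e]
  have h1 := tend_sum (p := p) m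
  have h2 := h1.comp (tendsto_add_atTop_nat 1)
  have := ((h2.sub (h1.const_mul ((p : ℚ_[p]) ^ (m - 1)))).sub_const (((p : ℚ_[p]) - 1) / p)).div_const (m : ℚ_[p])
  have hG : G p m = (((bernoulli m : ℚ) : ℚ_[p]) - (p : ℚ_[p]) ^ (m - 1) * ((bernoulli m : ℚ) : ℚ_[p])
      - ((p : ℚ_[p]) - 1) / p) / m := by
    unfold G; ring
  rw [hG]
  exact this

lemma CgG (hodd : p ≠ 2) (m n : ℕ) (hm : m ≠ 0) (hn : n ≠ 0)
    (hdm : (p - 1) ∣ m) (hdn : (p - 1) ∣ n) :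
    Cg (p := p) ‖(m : ℚ_[p]) - n‖ (G p m) (G p n) := by
  have c := fun N => CgW (p := p) hodd N m n hm hn hdm hdn
  have tm := tendW (p := p) m hm
  have tn := tendW (p := p) n hn
  exact ⟨le_of_tendsto tm.norm (Eventually.of_forall fun N => (c N).1),
    le_of_tendsto tn.norm (Eventually.of_forall fun N => (c N).2.1),
    le_of_tendsto (tm.sub tn).norm (Eventually.of_forall fun N => (c N).2.2)⟩

lemma zval (m : ℕ) (hm : m ≠ 0) : ((Zval p m : ℚ) : ℚ_[p]) =
    (1 - p - p * m * G p m) / (p * m) := by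
  have hm0 : (m : ℚ_[p]) ≠ 0 := by exact_mod_cast hm
  have hp0 := pne (p := p)
  rw [Zval, G]
  push_cast
  field_simp
  ring

lemma u_norm (m : ℕ) (h : ‖G p m‖ ≤ 1) : ‖1 - (p : ℚ_[p]) - p * m * G p m‖ = 1 := by
  have h1 : ‖-(p : ℚ_[p]) * (1 + m * G p m)‖ < 1 := by
    rw [norm_mul, norm_neg]
    have : ‖1 + (m : ℚ_[p]) * G p m‖ ≤ 1 := by
      refine (Padic.nonarchimedean _ _).trans (max_le (by simp) ?_)
      rw [norm_mul]; exact mul_le_one₀ (natle m) (norm_nonneg _) h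
    exact mul_lt_one_of_nonneg_of_lt_one_left (norm_nonneg _) Padic.norm_p_lt_one this
  rw [show 1 - (p : ℚ_[p]) - p * m * G p m = 1 + -(p : ℚ_[p]) * (1 + m * G p m) by ring]
  rw [Padic.add_eq_max_of_ne (by rw [norm_one]; exact h1.ne'), norm_one]
  exact max_eq_left h1.le

lemma final_alg (P x y g h k : ℚ_[p]) (hP : P ≠ 0) (hx : x ≠ 0) (hy : y ≠ 0) (hxy : x + y ≠ 0)
    (hu : 1 - P - P * (x + y) * k ≠ 0) :
    (1 - P - P * x * g) / (P * x) * ((1 - P - P * y * h) / (P * y)) /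
      ((1 - P - P * (x + y) * k) / (P * (x + y))) - (1 - P - P * x * g) / (P * x)
      - (1 - P - P * y * h) / (P * y) =
    (1 - P - P * (x + y) * k)⁻¹ * (((1 - P - P * x * g) + (1 - P - P * y * h)) * k
      + -((1 - P - P * x * g) * (y * ((h - k) / x)))
      + -((1 - P - P * y * h) * (x * ((g - k) / y)))) := by
  field_simp
  ring

lemma mul_le' {a b : ℚ_[p]} (ha : ‖a‖ ≤ 1) (hb : ‖b‖ ≤ 1) : ‖a * b‖ ≤ 1 := by
  rw [norm_mul]; exact mul_le_one₀ ha (norm_nonneg _) hb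

lemma add_le' {a b : ℚ_[p]} (ha : ‖a‖ ≤ 1) (hb : ‖b‖ ≤ 1) : ‖a + b‖ ≤ 1 :=
  (Padic.nonarchimedean _ _).trans (max_le ha hb)

end EZ

/-- Let `p` be an odd prime and `x, y ≥ 2` integers with `(p−1) ∣ x` and
`(p−1) ∣ y`.  Then `Z(x)Z(y)/Z(x+y) − Z(x) − Z(y)` is `p`-integral, i.e.
its denominator in lowest terms is not divisible by `p`. -/
theorem euler_factor_removed_zeta_p_integral (p : ℕ) (hp : p.Prime)
    (hodd : p ≠ 2) (x y : ℕ) (hx : 2 ≤ x) (hy : 2 ≤ y)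
    (hdx : (p - 1) ∣ x) (hdy : (p - 1) ∣ y) :
    ¬ p ∣ (Zval p x * Zval p y / Zval p (x + y) - Zval p x - Zval p y).den := by
  have : Fact p.Prime := ⟨hp⟩
  have hx0 : (x : ℚ_[p]) ≠ 0 := by exact_mod_cast (by omega : x ≠ 0)
  have hy0 : (y : ℚ_[p]) ≠ 0 := by exact_mod_cast (by omega : y ≠ 0)
  have hxy0 : (x : ℚ_[p]) + y ≠ 0 := by exact_mod_cast (by omega : x + y ≠ 0)
  have c1 := EZ.CgG hodd x (x + y) (by omega) (by omega) hdx (Dvd.dvd.add hdx hdy)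
  have c2 := EZ.CgG hodd y (x + y) (by omega) (by omega) hdy (Dvd.dvd.add hdx hdy)
  have ux := EZ.u_norm x c1.1
  have uy := EZ.u_norm y c2.1
  have uxy := EZ.u_norm (x + y) c1.2.1
  have main : ‖((Zval p x * Zval p y / Zval p (x + y) - Zval p x - Zval p y : ℚ) : ℚ_[p])‖ ≤ 1 := by
    push_cast
    rw [EZ.zval x (by omega), EZ.zval y (by omega), EZ.zval (x + y) (by omega)]
    push_cast at uxy ⊢
    rw [EZ.final_alg _ _ _ _ _ _ EZ.pne hx0 hy0 hxy0 (by rw [← norm_pos_iff, uxy]; norm_num)]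
    refine EZ.mul_le' (by rw [norm_inv, uxy]; simp) (EZ.add_le' (EZ.add_le'
      (EZ.mul_le' (EZ.add_le' ux.le uy.le) c1.2.1) ?_) ?_)
    · rw [norm_neg]
      refine EZ.mul_le' ux.le (EZ.mul_le' (EZ.natle y) ?_)
      rw [norm_div, div_le_one (norm_pos_iff.2 hx0)]
      have := c2.2.2
      rwa [show (y : ℚ_[p]) - (x + y : ℕ) = -x by push_cast; ring, norm_neg] at this
    · rw [norm_neg]
      refine EZ.mul_le' uy.le (EZ.mul_le' (EZ.natle x) ?_)
      rw [norm_div, div_le_one (norm_pos_iff.2 hy0)]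
      have := c1.2.2
      rwa [show (x : ℚ_[p]) - (x + y : ℕ) = -y by push_cast; ring, norm_neg] at this
  exact Rat.padicValuation_le_one_iff.1
    ((Padic.norm_rat_le_one_iff_padicValuation_le_one p).1 main)
end
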